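/- For every integer r ≥ 2 there exists a constant C > 0 such that for every finite r-regular simple graph G on N vertices with adjacency matrix A, and every integer k ≥ 1: (1/N) · Σ_v Ã^{(2k)}(v,v) / (r·(r−1)^{2k−1}) ≤ C·k·(r−1)^{−k} + (1/N)·Tr((A/r)^{2k}), where the sum is over all vertices v of G and Ã^{(2k)}(v,v) is the number of closed non-backtracking walks of length 2k based at v. -/

import Mathlib

/-- A walk is non-backtracking if no vertex equals the vertex two steps earlier. -/
def SimpleGraph.Walk.IsNonBacktracking {V : Type*} {G : SimpleGraph V} {u v : V}
    (p : G.Walk u v) : Prop :=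
  ∀ i, i + 2 ≤ p.length → p.getVert (i + 2) ≠ p.getVert i

/-- The number of non-backtracking walks of length `k` from `u` to `v` in `G`. -/
noncomputable def nbWalkCount {V : Type*} (G : SimpleGraph V) (u v : V) (k : ℕ) : ℕ :=
  Nat.card {p : G.Walk u v // p.length = k ∧ p.IsNonBacktracking}

open Polynomial in
/-- The polynomials of the normalized non-backtracking walk on a `(q + 1)`-regular graph: they
send the transition matrix of the simple random walk to that of the non-backtracking walk. -/
noncomputable def nbPoly (q : ℝ) : ℕ → ℝ[X]
  | 0 => 1
  | 1 => X
  | n + 2 => C ((q + 1) / q) * X * nbPoly q (n + 1) - C q⁻¹ * nbPoly q n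

theorem nbPoly_eval_add_two (q x : ℝ) (n : ℕ) :
    (nbPoly q (n + 2)).eval x =
      (q + 1) / q * x * (nbPoly q (n + 1)).eval x - q⁻¹ * (nbPoly q n).eval x := by
  simp [nbPoly]

theorem nbPoly_eval_neg (q x : ℝ) (n : ℕ) :
    (nbPoly q n).eval (-x) = (-1) ^ n * (nbPoly q n).eval x := by
  induction n using Nat.twoStepInduction with
  | zero => simp [nbPoly]
  | one => simp [nbPoly]
  | more n h₀ h₁ =>
    rw [nbPoly_eval_add_two, nbPoly_eval_add_two, h₀, h₁]
    ring

theorem nbPoly_eval_le_pow {q x : ℝ} (hq : 1 ≤ q) (hx₀ : 0 ≤ x) (hx₁ : x ≤ 1)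
    (hx : 4 * q ≤ ((q + 1) * x) ^ 2) (n : ℕ) : (nbPoly q n).eval x ≤ x ^ n := by
  have hq₀ : 0 < q := by linarith
  have hx_pos : 0 < x := hx₀.lt_of_ne (by rintro rfl; norm_num at hx; linarith)
  have key : ∀ n, 0 < (nbPoly q n).eval x ∧
      (q + 1) * x * (nbPoly q n).eval x ≤ 2 * q * (nbPoly q (n + 1)).eval x ∧
      (nbPoly q (n + 1)).eval x ≤ x * (nbPoly q n).eval x := by
    intro n
    induction n with
    | zero =>
      simp only [nbPoly, Polynomial.eval_one, Polynomial.eval_X, mul_one, le_refl,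
        and_true, zero_lt_one, true_and]
      nlinarith
    | succ n ih =>
      obtain ⟨h₀, h₁, h₂⟩ := ih
      have hrec : q * (nbPoly q (n + 2)).eval x =
          (q + 1) * x * (nbPoly q (n + 1)).eval x - (nbPoly q n).eval x := by
        rw [nbPoly_eval_add_two]
        field_simp
      set a := (nbPoly q n).eval x
      set b := (nbPoly q (n + 1)).eval x
      set c := (nbPoly q (n + 2)).eval x
      have hb : 0 < b := by
        have : 0 < (q + 1) * x * a := by positivity
        by_contra! hb
        nlinarith
      refine ⟨hb, ?_, ?_⟩
      · have h₃ : 4 * q * a ≤ ((q + 1) * x) ^ 2 * a := by gcongr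
        have h₄ : (q + 1) * x * ((q + 1) * x * a) ≤ (q + 1) * x * (2 * q * b) := by gcongr
        have : 0 ≤ q * ((q + 1) * x * b - 2 * a) := by nlinarith
        have := nonneg_of_mul_nonneg_right this hq₀
        change (q + 1) * x * b ≤ 2 * q * c
        linarith
      · have h₅ : x * b ≤ a := by nlinarith
        have : 0 ≤ q * (x * b - c) := by nlinarith
        have := nonneg_of_mul_nonneg_right this hq₀
        linarith
  induction n with
  | zero => simp [nbPoly]
  | succ n ih =>
    calc _ ≤ x * (nbPoly q n).eval x := (key n).2.2
      _ ≤ x * x ^ n := by gcongr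
      _ = x ^ (n + 1) := by ring

theorem abs_nbPoly_eval_le {q x : ℝ} (hq : 1 ≤ q) (hx : ((q + 1) * x) ^ 2 ≤ 4 * q) (n : ℕ) :
    |(nbPoly q n).eval x| ≤ (1 + 3 * n) * (√q)⁻¹ ^ n := by
  have hq₀ : 0 < q := by linarith
  set s := (√q)⁻¹ with hs
  have hs₀ : 0 < s := by positivity
  have hs₂ : s ^ 2 = q⁻¹ := by rw [hs, inv_pow, Real.sq_sqrt hq₀.le]
  set z : ℂ := ⟨(q + 1) * x / (2 * q), √(4 * q - ((q + 1) * x) ^ 2) / (2 * q)⟩ with hz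
  have hsq : √(4 * q - ((q + 1) * x) ^ 2) ^ 2 = 4 * q - ((q + 1) * x) ^ 2 :=
    Real.sq_sqrt (by linarith)
  have hnsq : Complex.normSq z = q⁻¹ := by
    rw [Complex.normSq_apply, hz]
    change (q + 1) * x / (2 * q) * ((q + 1) * x / (2 * q)) + _ / (2 * q) * (_ / (2 * q)) = _
    rw [div_mul_div_comm, div_mul_div_comm, ← add_div, ← pow_two (√_), hsq]
    field_simp
    ring
  have hzn : ‖z‖ = s := by
    rw [← Real.sqrt_sq (norm_nonneg z), ← Complex.normSq_eq_norm_sq, hnsq, hs, Real.sqrt_inv]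
  have hadd : z + (starRingEnd ℂ) z = (((q + 1) / q * x : ℝ) : ℂ) := by
    rw [Complex.add_conj, hz]
    congr 1
    field_simp
  have hmul : z * (starRingEnd ℂ) z = ((q⁻¹ : ℝ) : ℂ) := by rw [Complex.mul_conj, hnsq]
  have hx_le : |x| ≤ 2 * s := by
    apply abs_le_of_sq_le_sq _ (by positivity)
    rw [mul_pow, hs₂, ← div_eq_mul_inv, le_div_iff₀ hq₀]
    nlinarith [sq_nonneg x, mul_nonneg hq₀.le (sq_nonneg x)]
  set f : ℕ → ℝ := fun n => (nbPoly q n).eval x with hf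
  have hrec (n : ℕ) : f (n + 2) = (q + 1) / q * x * f (n + 1) - q⁻¹ * f n :=
    nbPoly_eval_add_two q x n
  change |f n| ≤ _
  have key : ∀ n, ‖(f (n + 1) : ℂ) - z * (f n : ℂ)‖
      ≤ 3 * s ^ (n + 1) := by
    intro n
    induction n with
    | zero =>
      calc _ ≤ ‖(x : ℂ)‖ + ‖z‖ := by simpa [hf, nbPoly] using norm_sub_le (x : ℂ) z
        _ ≤ 3 * s ^ (0 + 1) := by
          rw [Complex.norm_real, Real.norm_eq_abs, hzn, zero_add]
          linarith [pow_one s]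
    | succ n ih =>
      have : (f (n + 2) : ℂ) - z * (f (n + 1) : ℂ) =
          (starRingEnd ℂ) z *
            ((f (n + 1) : ℂ) - z * (f n : ℂ)) := by
        rw [hrec, Complex.ofReal_sub, Complex.ofReal_mul, Complex.ofReal_mul q⁻¹,
          ← hadd, ← hmul]
        ring
      rw [this, norm_mul, Complex.norm_conj, hzn]
      calc _ ≤ s * (3 * s ^ (n + 1)) := by gcongr
        _ = _ := by ring
  induction n with
  | zero => simp [hf, nbPoly]
  | succ n ih =>
    have h := norm_le_norm_sub_add (f (n + 1) : ℂ) (z * (f n : ℂ))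
    rw [norm_mul, hzn, Complex.norm_real, Complex.norm_real, Real.norm_eq_abs,
      Real.norm_eq_abs] at h
    calc _ ≤ _ := h
      _ ≤ 3 * s ^ (n + 1) + s * ((1 + 3 * n) * s ^ n) := by
        gcongr
        exact key n
      _ = _ := by
        push_cast
        ring

theorem nbPoly_eval_two_mul_le {q x : ℝ} (hq : 1 ≤ q) (hx : |x| ≤ 1) {k : ℕ} (hk : 1 ≤ k) :
    (nbPoly q (2 * k)).eval x ≤ 7 * k * q⁻¹ ^ k + x ^ (2 * k) := by
  have hq₀ : 0 < q := by linarith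
  have hk' : (1 : ℝ) ≤ k := by exact_mod_cast hk
  have h_pow : 0 ≤ x ^ (2 * k) := by rw [pow_mul]; positivity
  have h_abs : (nbPoly q (2 * k)).eval |x| = (nbPoly q (2 * k)).eval x := by
    obtain h | h := abs_choice x <;> simp [h, nbPoly_eval_neg]
  obtain h | h := le_total ((q + 1) * |x|) (2 * √q)
  · have h' : ((q + 1) * |x|) ^ 2 ≤ 4 * q := by
      calc _ ≤ (2 * √q) ^ 2 := by gcongr
        _ = _ := by rw [mul_pow, Real.sq_sqrt hq₀.le]; norm_num
    have := (le_abs_self _).trans (abs_nbPoly_eval_le hq h' (2 * k))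
    rw [h_abs, pow_mul, inv_pow, Real.sq_sqrt hq₀.le] at this
    push_cast at this
    have h₂ : (1 + 3 * (2 * k : ℝ)) * q⁻¹ ^ k ≤ 7 * k * q⁻¹ ^ k := by
      gcongr
      linarith
    linarith
  · have h' : 4 * q ≤ ((q + 1) * |x|) ^ 2 := by
      calc 4 * q = (2 * √q) ^ 2 := by rw [mul_pow, Real.sq_sqrt hq₀.le]; norm_num
        _ ≤ _ := by gcongr
    have := nbPoly_eval_le_pow hq (abs_nonneg x) hx h' (2 * k)
    rw [h_abs, pow_mul, sq_abs, ← pow_mul] at this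
    have : 0 ≤ 7 * k * q⁻¹ ^ k := by positivity
    linarith

theorem Matrix.IsHermitian.trace_aeval {n : Type*} [Fintype n] [DecidableEq n]
    {A : Matrix n n ℝ} (hA : A.IsHermitian) (p : Polynomial ℝ) :
    (Polynomial.aeval A p).trace = ∑ i, p.eval (hA.eigenvalues i) := by
  have h : Polynomial.aeval A p = Unitary.conjStarAlgAut ℝ _ hA.eigenvectorUnitary
      (Polynomial.aeval (Matrix.diagonal hA.eigenvalues) p) := by
    conv_lhs => rw [hA.spectral_theorem]
    exact Polynomial.aeval_algHom_apply
      (Unitary.conjStarAlgAut ℝ (Matrix n n ℝ) hA.eigenvectorUnitary) _ p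
  have hdiag : Polynomial.aeval (Matrix.diagonal hA.eigenvalues) p =
      Matrix.diagonal fun i => p.eval (hA.eigenvalues i) := by
    rw [← Matrix.diagonalAlgHom_apply ℝ, Polynomial.aeval_algHom_apply,
      Matrix.diagonalAlgHom_apply]
    congr 1
    ext i
    simp
  rw [h, hdiag, Unitary.conjStarAlgAut_apply, Matrix.trace_mul_cycle]
  simp [Matrix.trace_diagonal]

theorem Matrix.IsHermitian.abs_eigenvalues_le_of_sum_le {n : Type*} [Fintype n] [DecidableEq n]
    {A : Matrix n n ℝ} (hA : A.IsHermitian) {c : ℝ} (hc : ∀ i, ∑ j, |A i j| ≤ c) (i : n) :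
    |hA.eigenvalues i| ≤ c := by
  have hev : Module.End.HasEigenvalue (Matrix.toLin' A) (hA.eigenvalues i) := by
    refine Module.End.hasEigenvalue_of_hasEigenvector (x := (hA.eigenvectorBasis i).ofLp) ⟨?_, ?_⟩
    · rw [Module.End.mem_eigenspace_iff, Matrix.toLin'_apply, hA.mulVec_eigenvectorBasis]
    · exact (WithLp.ofLp_eq_zero 2).ne.2 <| hA.eigenvectorBasis.orthonormal.ne_zero i
  obtain ⟨k, hk⟩ := eigenvalue_mem_ball hev
  rw [Metric.mem_closedBall, Real.dist_eq] at hk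
  have h := hc k
  rw [← Finset.add_sum_erase _ _ (Finset.mem_univ k)] at h
  simp only [Real.norm_eq_abs] at hk
  have := abs_sub_abs_le_abs_sub (hA.eigenvalues i) (A k k)
  linarith

/-- The number of non-backtracking walks of length `n` from `u` to `v` whose vertex at time `1`
is not `w`. -/
noncomputable def nbWalkCountAvoid {V : Type*} (G : SimpleGraph V) (w u v : V) (n : ℕ) : ℕ :=
  Nat.card {p : G.Walk u v // p.length = n ∧ p.IsNonBacktracking ∧ p.getVert 1 ≠ w}

theorem SimpleGraph.Walk.isNonBacktracking_cons {V : Type*} {G : SimpleGraph V} {u v w : V}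
    (h : G.Adj u v) (p : G.Walk v w) :
    (cons h p).IsNonBacktracking ↔ p.IsNonBacktracking ∧ p.getVert 1 ≠ u := by
  constructor
  · intro hp
    refine ⟨fun i hi => by simpa using hp (i + 1) (by simp; omega), ?_⟩
    cases p with
    | nil => exact h.ne'
    | cons h' p => simpa using hp 0 (by simp)
  · rintro ⟨hp, hu⟩ (_ | i) hi
    · simpa using hu
    · simpa using hp i (by simp at hi; omega)

namespace SimpleGraph

variable {V : Type*} (G : SimpleGraph V)

/-- Walks of length `n + 1` with a given property, split by their first step. -/
def walkLengthSuccEquiv (u v : V) (n : ℕ) (Q : G.Walk u v → Prop) :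
    {p : G.Walk u v // p.length = n + 1 ∧ Q p} ≃
      Σ x : {x // G.Adj u x}, {p : G.Walk x v // p.length = n ∧ Q (.cons x.2 p)} where
  toFun
    | ⟨.cons (v := x) h p, hp⟩ => ⟨⟨x, h⟩, p, by simpa using hp.1, hp.2⟩
  invFun y := ⟨.cons y.1.2 y.2.1, by simp [y.2.2.1], y.2.2.2⟩
  left_inv
    | ⟨.cons h p, hp⟩ => rfl
  right_inv _ := rfl

theorem nbWalkCount_zero [DecidableEq V] (u v : V) :
    nbWalkCount G u v 0 = (1 : Matrix V V ℕ) u v := by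
  obtain rfl | h := eq_or_ne u v
  · rw [nbWalkCount, Matrix.one_apply_eq, Nat.card_eq_one_iff_unique]
    refine ⟨⟨fun p q => Subtype.ext ?_⟩, ⟨⟨.nil, rfl, fun i hi => by simp at hi⟩⟩⟩
    rw [(Walk.length_eq_zero_iff.1 p.2.1).eq_nil, (Walk.length_eq_zero_iff.1 q.2.1).eq_nil]
  · rw [nbWalkCount, Matrix.one_apply_ne h, Nat.card_eq_zero]
    exact .inl ⟨fun p => h (Walk.eq_of_length_eq_zero p.2.1)⟩

theorem nbWalkCountAvoid_zero {w u : V} (v : V) (h : w ≠ u) :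
    nbWalkCountAvoid G w u v 0 = nbWalkCount G u v 0 := by
  refine Nat.card_congr (Equiv.subtypeEquivRight fun p => ?_)
  refine and_congr_right fun hp => and_iff_left ?_
  rw [p.getVert_of_length_le (by omega), ← Walk.eq_of_length_eq_zero hp]
  exact h.symm

variable [Fintype V] [DecidableEq V] [DecidableRel G.Adj]

instance finite_walk_length (u v : V) (n : ℕ) (Q : G.Walk u v → Prop) :
    Finite {p : G.Walk u v // p.length = n ∧ Q p} :=
  .of_injective (β := {p : G.Walk u v // p.length = n}) (fun p => ⟨p.1, p.2.1⟩)
    fun _ _ h => Subtype.ext (congrArg (fun p => p.1) h)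

theorem card_walk_length_succ (u v : V) (n : ℕ) (Q : G.Walk u v → Prop) :
    Nat.card {p : G.Walk u v // p.length = n + 1 ∧ Q p} =
      ∑ x : {x // G.Adj u x}, Nat.card {p : G.Walk x v // p.length = n ∧ Q (.cons x.2 p)} := by
  rw [Nat.card_congr (G.walkLengthSuccEquiv u v n Q), Nat.card_sigma]

theorem nbWalkCount_succ (u v : V) (n : ℕ) :
    nbWalkCount G u v (n + 1) = ∑ x ∈ G.neighborFinset u, nbWalkCountAvoid G u x v n := by
  rw [nbWalkCount, card_walk_length_succ, Finset.sum_subtype (p := G.Adj u) _ (by simp)]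
  simp only [Walk.isNonBacktracking_cons]
  rfl

theorem nbWalkCountAvoid_succ (w u v : V) (n : ℕ) :
    nbWalkCountAvoid G w u v (n + 1) =
      ∑ x ∈ (G.neighborFinset u).erase w, nbWalkCountAvoid G u x v n := by
  rw [nbWalkCountAvoid, card_walk_length_succ, ← Finset.filter_ne', Finset.sum_filter,
    Finset.sum_subtype (p := G.Adj u) _ (by simp)]
  refine Finset.sum_congr rfl fun x _ => ?_
  simp only [Walk.isNonBacktracking_cons, Walk.getVert_cons_succ, Walk.getVert_zero]
  split_ifs with h
  · simp [h, nbWalkCountAvoid]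
  · simp [h]

theorem nbWalkCount_succ_eq_add {w u : V} (v : V) (h : G.Adj u w) (n : ℕ) :
    nbWalkCount G u v (n + 1) = nbWalkCountAvoid G w u v (n + 1) + nbWalkCountAvoid G u w v n := by
  rw [nbWalkCount_succ, nbWalkCountAvoid_succ, Finset.sum_erase_add]
  simpa using h

variable {G} {q : ℕ}

theorem IsRegularOfDegree.sum_nbWalkCount_one (hG : G.IsRegularOfDegree (q + 1)) (u v : V) :
    ∑ w ∈ G.neighborFinset u, nbWalkCount G w v 1 =
      nbWalkCount G u v 2 + (q + 1) * nbWalkCount G u v 0 := by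
  have h : ∀ w ∈ G.neighborFinset u, nbWalkCount G w v 1 =
      nbWalkCountAvoid G u w v 1 + nbWalkCount G u v 0 := fun w hw => by
    have hw : G.Adj u w := by simpa using hw
    rw [G.nbWalkCount_succ_eq_add v hw.symm 0, G.nbWalkCountAvoid_zero v hw.ne']
  rw [Finset.sum_congr rfl h, Finset.sum_add_distrib, ← nbWalkCount_succ, Finset.sum_const,
    card_neighborFinset_eq_degree, hG u, smul_eq_mul]

theorem IsRegularOfDegree.sum_nbWalkCount_add_two (hG : G.IsRegularOfDegree (q + 1)) (u v : V)
    (n : ℕ) :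
    ∑ w ∈ G.neighborFinset u, nbWalkCount G w v (n + 2) =
      nbWalkCount G u v (n + 3) + q * nbWalkCount G u v (n + 1) := by
  have h : ∀ w ∈ G.neighborFinset u, nbWalkCount G w v (n + 2) =
      nbWalkCountAvoid G u w v (n + 2) + nbWalkCountAvoid G w u v (n + 1) := fun w hw => by
    have hw : G.Adj u w := by simpa using hw
    rw [G.nbWalkCount_succ_eq_add v hw.symm (n + 1)]
  have h' : ∀ w ∈ G.neighborFinset u, nbWalkCount G u v (n + 1) =
      nbWalkCountAvoid G w u v (n + 1) + nbWalkCountAvoid G u w v n := fun w hw => by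
    have hw : G.Adj u w := by simpa using hw
    exact G.nbWalkCount_succ_eq_add v hw n
  have h'' := Finset.sum_congr rfl h'
  rw [Finset.sum_add_distrib, ← nbWalkCount_succ, Finset.sum_const,
    card_neighborFinset_eq_degree, hG u, smul_eq_mul] at h''
  rw [Finset.sum_congr rfl h, Finset.sum_add_distrib, ← nbWalkCount_succ]
  linarith

/-- Up to normalization, the matrix of non-backtracking walk counts is a polynomial in the
transition matrix of the simple random walk. -/
theorem IsRegularOfDegree.nbWalkCount_eq_aeval (hG : G.IsRegularOfDegree (q + 1)) (hq : q ≠ 0)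
    (n : ℕ) :
    (Matrix.of fun u v => (nbWalkCount G u v (n + 1) : ℝ)) = (((q : ℝ) + 1) * (q : ℝ) ^ n) •
      Polynomial.aeval (((q : ℝ) + 1)⁻¹ • G.adjMatrix ℝ) (nbPoly q (n + 1)) := by
  have hq' : (q : ℝ) ≠ 0 := by exact_mod_cast hq
  have hr : (q : ℝ) + 1 ≠ 0 := by positivity
  set B : ℕ → Matrix V V ℝ := fun n => Matrix.of fun u v => (nbWalkCount G u v n : ℝ) with hB
  set M := ((q : ℝ) + 1)⁻¹ • G.adjMatrix ℝ with hM
  have hA : G.adjMatrix ℝ = ((q : ℝ) + 1) • M := by rw [hM, smul_inv_smul₀ hr]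
  have h₀ : B 0 = 1 := by
    ext u v
    simp [hB, nbWalkCount_zero, Matrix.one_apply]
  have h₁ : B 1 = G.adjMatrix ℝ := by
    rw [← mul_one (G.adjMatrix ℝ), ← h₀]
    ext u v
    rw [adjMatrix_mul_apply]
    simp only [hB, Matrix.of_apply]
    rw [nbWalkCount_succ]
    push_cast
    refine Finset.sum_congr rfl fun x hx => ?_
    rw [nbWalkCountAvoid_zero G v (G.ne_of_adj (by simpa using hx))]
  have h₂ : B 2 = G.adjMatrix ℝ * B 1 - ((q : ℝ) + 1) • B 0 := by
    rw [eq_sub_iff_add_eq]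
    ext u v
    rw [adjMatrix_mul_apply]
    simp only [hB, Matrix.of_apply, Matrix.add_apply, Matrix.smul_apply, smul_eq_mul]
    exact_mod_cast (hG.sum_nbWalkCount_one u v).symm
  have h₃ (n : ℕ) : B (n + 3) = G.adjMatrix ℝ * B (n + 2) - (q : ℝ) • B (n + 1) := by
    rw [eq_sub_iff_add_eq]
    ext u v
    rw [adjMatrix_mul_apply]
    simp only [hB, Matrix.of_apply, Matrix.add_apply, Matrix.smul_apply, smul_eq_mul]
    exact_mod_cast (hG.sum_nbWalkCount_add_two u v n).symm
  have hP (n : ℕ) : Polynomial.aeval M (nbPoly q (n + 2)) =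
      (((q : ℝ) + 1) / q) • (M * Polynomial.aeval M (nbPoly q (n + 1))) -
        (q : ℝ)⁻¹ • Polynomial.aeval M (nbPoly q n) := by
    simp [nbPoly, Algebra.algebraMap_eq_smul_one]
  change B (n + 1) = _
  induction n using Nat.twoStepInduction with
  | zero => simp [h₁, nbPoly, hA]
  | one =>
    rw [h₂, h₁, h₀, hP, hA]
    simp only [nbPoly, Polynomial.aeval_X, map_one, smul_sub, smul_smul, smul_mul_smul_comm]
    congr 2 <;> field_simp
  | more n ih₀ ih₁ =>
    rw [h₃, ih₀, ih₁, hP (n + 1), hA]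
    simp only [smul_sub, smul_smul, smul_mul_smul_comm]
    congr 2 <;> field_simp <;> ring

end SimpleGraph

/-- For every `r ≥ 2` there is a constant `C > 0` such that for every
finite `r`-regular simple graph on `N` vertices and every `k ≥ 1`, the average return
probability of the non-backtracking random walk after `2k` steps is bounded by
`C·k·(r−1)^{−k}` plus the average return probability of the simple random walk. -/
theorem avg_nb_return_prob_le (r : ℕ) (hr : 2 ≤ r) :
    ∃ C : ℝ, 0 < C ∧
      ∀ (V : Type) [Fintype V] [DecidableEq V] (G : SimpleGraph V) [DecidableRel G.Adj],
        G.IsRegularOfDegree r →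
        ∀ k : ℕ, 1 ≤ k →
          (1 / (Fintype.card V : ℝ)) *
              ∑ v : V, (nbWalkCount G v v (2 * k) : ℝ) / ((r : ℝ) * ((r : ℝ) - 1) ^ (2 * k - 1)) ≤
            C * k * (((r : ℝ) - 1)⁻¹) ^ k +
              (1 / (Fintype.card V : ℝ)) * Matrix.trace (((r : ℝ)⁻¹ • G.adjMatrix ℝ) ^ (2 * k)) := by
  obtain ⟨q, rfl⟩ : ∃ q, r = q + 1 := ⟨r - 1, by omega⟩
  have hq : 1 ≤ q := by omega
  have hq' : (1 : ℝ) ≤ q := by exact_mod_cast hq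
  have hq₀ : (0 : ℝ) < q := by linarith
  refine ⟨7, by norm_num, fun V _ _ G _ hG k hk => ?_⟩
  push_cast
  rw [add_sub_cancel_right]
  set M := ((q : ℝ) + 1)⁻¹ • G.adjMatrix ℝ with hM
  have hM_herm : M.IsHermitian := by
    rw [hM, Matrix.IsHermitian, Matrix.conjTranspose_smul, star_trivial, G.isHermitian_adjMatrix ℝ]
  have hM_le (i : V) : |hM_herm.eigenvalues i| ≤ 1 := by
    refine hM_herm.abs_eigenvalues_le_of_sum_le (fun u => le_of_eq ?_) i
    have hdeg : ∑ v, |G.adjMatrix ℝ u v| = q + 1 := by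
      simp only [SimpleGraph.adjMatrix_apply, apply_ite abs, abs_one, abs_zero, Finset.sum_boole,
        ← SimpleGraph.neighborFinset_eq_filter, SimpleGraph.card_neighborFinset_eq_degree, hG u]
      push_cast
      rfl
    simp only [hM, Matrix.smul_apply, smul_eq_mul, abs_mul]
    rw [← Finset.mul_sum, hdeg, abs_of_pos (by positivity), inv_mul_cancel₀ (by positivity)]
  have hsum : ∑ v : V, (nbWalkCount G v v (2 * k) : ℝ) / (((q : ℝ) + 1) * (q : ℝ) ^ (2 * k - 1)) =
      ∑ i, (nbPoly q (2 * k)).eval (hM_herm.eigenvalues i) := by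
    have h := congrArg Matrix.trace (hG.nbWalkCount_eq_aeval (by omega) (2 * k - 1))
    rw [Nat.sub_add_cancel (by omega), Matrix.trace_smul, hM_herm.trace_aeval] at h
    rw [← Finset.sum_div, div_eq_iff (by positivity)]
    exact h.trans (mul_comm _ _)
  have htrace : (M ^ (2 * k)).trace = ∑ i, hM_herm.eigenvalues i ^ (2 * k) := by
    simpa using hM_herm.trace_aeval (Polynomial.X ^ (2 * k))
  rw [hsum, htrace]
  have hC : 0 ≤ 7 * k * (q : ℝ)⁻¹ ^ k := by positivity
  calc _ ≤ 1 / (Fintype.card V : ℝ) *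
        ∑ i, (7 * k * (q : ℝ)⁻¹ ^ k + hM_herm.eigenvalues i ^ (2 * k)) := by
        gcongr with i
        exact nbPoly_eval_two_mul_le hq' (hM_le i) hk
    _ = (Fintype.card V : ℝ) / Fintype.card V * (7 * k * (q : ℝ)⁻¹ ^ k) +
        1 / (Fintype.card V : ℝ) * ∑ i, hM_herm.eigenvalues i ^ (2 * k) := by
        rw [Finset.sum_add_distrib, Finset.sum_const, Finset.card_univ, nsmul_eq_mul]
        ring
    _ ≤ _ := add_le_add (mul_le_of_le_one_left hC (div_self_le_one _)) le_rfl
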